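/- arXiv:1707.08099 — 8 statements merged into one kernel-verified Lean document; each statement's English description precedes it below -/
import Mathlib

section
/- Let T be any one of the four interval types A, B, C, D, and let P be a finite poset. Then P admits a {T}-representation (an S-representation with S = {T}) if and only if P is a unit interval order. -/
/-- The four interval types. -/
inductive IType : Type
  | A
  | B
  | C
  | D
  deriving DecidableEq

/-- `typeComp s t` holds iff `s = B`, or `t = B`, or `s = t = C`, or `s = t = D`. -/
def typeComp : IType → IType → Prop := fun s t =>
  s = IType.B ∨ t = IType.B ∨ (s = IType.C ∧ t = IType.C) ∨ (s = IType.D ∧ t = IType.D)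

/-- An `S`-representation of the poset `(X, prec)`: centers `c` and types `τ` with
`τ x ∈ S` for all `x`, such that `prec x y ↔ c x + 1 < c y ∨ (c x + 1 = c y ∧ comp (τ x) (τ y))`. -/
def SRep {X : Type*} (prec : X → X → Prop) (S : Set IType) (c : X → ℝ) (τ : X → IType) : Prop :=
  (∀ x, τ x ∈ S) ∧
    ∀ x y, prec x y ↔ (c x + 1 < c y ∨ (c x + 1 = c y ∧ typeComp (τ x) (τ y)))

/-- A poset is an `S`-order if it admits an `S`-representation. -/
def SOrder {X : Type*} (prec : X → X → Prop) (S : Set IType) : Prop :=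
  ∃ c τ, SRep prec S c τ

/-- Incomparability `x ∥ y`. -/
def Incomp {X : Type*} (prec : X → X → Prop) (x y : X) : Prop :=
  ¬ prec x y ∧ ¬ prec y x

/-- `x 0, x 1, …, x t` is a forcing trail: each step is an up-step or a side-step. -/
def ForcingTrail {X : Type*} (prec : X → X → Prop) (t : ℕ) (x : ℕ → X) : Prop :=
  ∀ i < t, prec (x i) (x (i + 1)) ∨ Incomp prec (x i) (x (i + 1))

open scoped Classical in
/-- `trailVal prec x i` = number of up-steps minus number of side-steps among the
first `i` steps of the trail `x`. -/
noncomputable def trailVal {X : Type*} (prec : X → X → Prop) (x : ℕ → X) (i : ℕ) : ℤ :=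
  ∑ j ∈ Finset.range i, if prec (x j) (x (j + 1)) then 1 else -1

/-- A unit interval order. -/
def UnitIntervalOrder {X : Type*} (prec : X → X → Prop) : Prop :=
  ∃ f : X → ℝ, ∀ x y, prec x y ↔ f x + 1 < f y

/-- Exchange the types `C` and `D`, fixing `A` and `B`. -/
def swapCD : IType → IType
  | IType.C => IType.D
  | IType.D => IType.C
  | t => t

/-- Two distinct elements are twins if they are incomparable and have the same
comparabilities with every other element. -/
def Twins {X : Type*} (prec : X → X → Prop) (x y : X) : Prop :=
  x ≠ y ∧ Incomp prec x y ∧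
    ∀ z, z ≠ x → z ≠ y → ((prec z x ↔ prec z y) ∧ (prec x z ↔ prec y z))

/-- A poset is twin-free if it contains no twins. -/
def TwinFree {X : Type*} (prec : X → X → Prop) : Prop :=
  ∀ x y, ¬ Twins prec x y

/-- A unit OC interval order: unit intervals with left endpoint `g x`, open iff `o x`. -/
def UnitOCOrder {X : Type*} (prec : X → X → Prop) : Prop :=
  ∃ (g : X → ℝ) (o : X → Bool), ∀ x y,
    prec x y ↔ (g x + 1 < g y ∨ (g x + 1 = g y ∧ (o x = true ∨ o y = true)))

/-- `P` contains an induced copy of `Q`. -/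
def ContainsInduced {X : Type*} {Q : Type*} (prec : X → X → Prop) (qrel : Q → Q → Prop) : Prop :=
  ∃ f : Q → X, Function.Injective f ∧ ∀ a b, qrel a b ↔ prec (f a) (f b)

/-- The poset `2+2`: elements `a = 0, b = 1, p = 2, q = 3`; relations `a ≺ b`, `p ≺ q`. -/
def rel2p2 : Fin 4 → Fin 4 → Prop := fun i j =>
  (i = 0 ∧ j = 1) ∨ (i = 2 ∧ j = 3)

/-- The poset `3+1`: a chain `0 ≺ 1 ≺ 2` plus the isolated element `3`. -/
def rel3p1 : Fin 4 → Fin 4 → Prop := fun i j =>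
  (i : ℕ) < (j : ℕ) ∧ (j : ℕ) ≤ 2

/-- The poset `4+1`: a chain `0 ≺ 1 ≺ 2 ≺ 3` plus the isolated element `4`. -/
def rel4p1 : Fin 5 → Fin 5 → Prop := fun i j =>
  (i : ℕ) < (j : ℕ) ∧ (j : ℕ) ≤ 3

/-- The poset `3+1+1`: a chain `0 ≺ 1 ≺ 2` plus isolated elements `3, 4`. -/
def rel3p1p1 : Fin 5 → Fin 5 → Prop := fun i j =>
  (i : ℕ) < (j : ℕ) ∧ (j : ℕ) ≤ 2

/-- The poset `Z`: `x = 0, y = 1, z = 2, w = 3, u = 4, v = 5` with relations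
`x≺y, x≺z, x≺w, y≺z, y≺w, z≺w, x≺v, u≺w`. -/
def relZ : Fin 6 → Fin 6 → Prop := fun i j =>
  ((i : ℕ) < (j : ℕ) ∧ (j : ℕ) ≤ 3) ∨ (i = 0 ∧ j = 5) ∨ (i = 4 ∧ j = 3)

/-- The poset `D`: `x = 0, y = 1, w = 2, z = 3, v = 4` with relations
`x≺y, x≺w, x≺z, y≺z, w≺z`. -/
def relD : Fin 5 → Fin 5 → Prop := fun i j =>
  (i = 0 ∧ (j = 1 ∨ j = 2 ∨ j = 3)) ∨ ((i = 1 ∨ i = 2) ∧ j = 3)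

/-- The poset `Y`: `x = 0, y = 1, z = 2, w = 3, v = 4` with relations
`x≺y, x≺z, x≺w, y≺z, y≺w`. -/
def relY : Fin 5 → Fin 5 → Prop := fun i j =>
  (i = 0 ∧ (j = 1 ∨ j = 2 ∨ j = 3)) ∨ (i = 1 ∧ (j = 2 ∨ j = 3))

/-- The poset `H`: `x = 0, y = 1, z = 2, w = 3, u = 4, v = 5` with relations
`x≺y, x≺z, x≺w, y≺z, y≺w, z≺w, x≺u, y≺u, v≺z, v≺w`. -/
def relH : Fin 6 → Fin 6 → Prop := fun i j =>
  ((i : ℕ) < (j : ℕ) ∧ (j : ℕ) ≤ 3) ∨ ((i = 0 ∨ i = 1) ∧ j = 4) ∨ (i = 5 ∧ (j = 2 ∨ j = 3))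

/-- The poset `V`: `x = 0, b = 1, c = 2, d = 3, e = 4, f = 5` with relations
`x≺b, x≺c, x≺d, x≺e, b≺d, c≺e`. -/
def relV : Fin 6 → Fin 6 → Prop := fun i j =>
  (i = 0 ∧ (j = 1 ∨ j = 2 ∨ j = 3 ∨ j = 4)) ∨ (i = 1 ∧ j = 3) ∨ (i = 2 ∧ j = 4)

/-- Two elements of the same type are compatible precisely when that type is not `A`. -/
theorem typeComp_self_iff (T : IType) : typeComp T T ↔ T ≠ IType.A := by
  cases T <;> simp [typeComp]

theorem sOrder_singleton_iff {X : Type*} (prec : X → X → Prop) (T : IType) :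
    SOrder prec {T} ↔
      ∃ c : X → ℝ, ∀ x y, prec x y ↔ (c x + 1 < c y ∨ (c x + 1 = c y ∧ T ≠ IType.A)) := by
  constructor
  · rintro ⟨c, τ, hτ, h⟩
    obtain rfl : τ = fun _ => T := funext hτ
    exact ⟨c, by simpa only [typeComp_self_iff] using h⟩
  · rintro ⟨c, h⟩
    exact ⟨c, fun _ => T, fun _ => rfl, by simpa only [typeComp_self_iff] using h⟩

/-- Among finitely many reals, a strict lower bound `a` can be replaced by a weak lower bound
that is slightly larger. -/
theorem exists_gt_forall_lt_iff_le {ι : Type*} [Finite ι] (d : ι → ℝ) (a : ℝ) :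
    ∃ b > a, ∀ i, a < d i ↔ b ≤ d i := by
  have h : ∀ᶠ b in nhdsWithin a (Set.Ioi a), ∀ i, a < d i → b ≤ d i := by
    refine Filter.eventually_all.2 fun i => ?_
    by_cases hi : a < d i
    · filter_upwards [Ioc_mem_nhdsGT hi] with b hb _ using hb.2
    · exact Filter.Eventually.of_forall fun b hb => absurd hb hi
  obtain ⟨b, hb, hab⟩ := (h.and self_mem_nhdsWithin).exists
  exact ⟨b, hab, fun i => ⟨hb i, fun hi => lt_of_lt_of_le hab hi⟩⟩

/-- Among finitely many reals, a weak lower bound `a` can be replaced by a strict lower bound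
that is slightly smaller, and still larger than any prescribed `l < a`. -/
theorem exists_mem_Ioo_forall_le_iff_lt {ι : Type*} [Finite ι] (d : ι → ℝ) {l a : ℝ}
    (hl : l < a) : ∃ b ∈ Set.Ioo l a, ∀ i, a ≤ d i ↔ b < d i := by
  have h : ∀ᶠ b in nhdsWithin a (Set.Iio a), ∀ i, d i < a → d i ≤ b := by
    refine Filter.eventually_all.2 fun i => ?_
    by_cases hi : d i < a
    · filter_upwards [Ico_mem_nhdsLT hi] with b hb _ using hb.1
    · exact Filter.Eventually.of_forall fun b hb => absurd hb hi
  obtain ⟨b, hb, hab⟩ := (h.and (Ioo_mem_nhdsLT hl)).exists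
  refine ⟨b, hab, fun i => ⟨fun hi => lt_of_lt_of_le hab.2 hi, fun hi => ?_⟩⟩
  by_contra! hlt
  exact absurd (hb i hlt) (not_le.2 hi)

/-- On a finite set, closed and open unit intervals represent the same orders. -/
theorem unitIntervalOrder_iff_exists_le {X : Type*} [Finite X] (prec : X → X → Prop) :
    UnitIntervalOrder prec ↔ ∃ c : X → ℝ, ∀ x y, prec x y ↔ c x + 1 ≤ c y := by
  constructor
  · rintro ⟨f, hf⟩
    obtain ⟨b, hb, h⟩ := exists_gt_forall_lt_iff_le (fun p : X × X => f p.2 - f p.1) 1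
    have hb0 : 0 < b := one_pos.trans hb
    refine ⟨fun x => f x / b, fun x y => ?_⟩
    rw [hf, ← lt_sub_iff_add_lt', h (x, y), div_add_one hb0.ne',
      div_le_div_iff_of_pos_right hb0, le_sub_iff_add_le']
  · rintro ⟨f, hf⟩
    obtain ⟨b, ⟨hb0, -⟩, h⟩ :=
      exists_mem_Ioo_forall_le_iff_lt (fun p : X × X => f p.2 - f p.1) one_pos
    refine ⟨fun x => f x / b, fun x y => ?_⟩
    rw [hf, ← le_sub_iff_add_le', h (x, y), div_add_one hb0.ne',
      div_lt_div_iff_of_pos_right hb0, lt_sub_iff_add_lt']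

/-- For any single interval type `T`, a finite poset admits a `{T}`-representation
iff it is a unit interval order. -/
theorem stmt_0 {X : Type*} [Finite X] (prec : X → X → Prop)
    (hirr : ∀ x, ¬ prec x x)
    (htrans : ∀ x y z, prec x y → prec y z → prec x z)
    (T : IType) :
    SOrder prec {T} ↔ UnitIntervalOrder prec := by
  rw [sOrder_singleton_iff]
  by_cases hT : T = IType.A
  · simp [hT, UnitIntervalOrder]
  · simp [hT, unitIntervalOrder_iff_exists_le, le_iff_lt_or_eq]
end

section
/- Let P be a poset with an {A,B,C,D}-representation (c,τ), and let T : x_0, x_1, …, x_t be a forcing trail in P. Then (i) c(x_i) ≥ c(x_0) + val_T(x_i) for all 0 ≤ i ≤ t; and (ii) if c(x_i) > c(x_0) + val_T(x_i) for some i, then c(x_j) > c(x_0) + val_T(x_j) for all j with i ≤ j ≤ t. -/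
/-- A step of a forcing trail raises the center by at least the increment of the value. -/
theorem ForcingTrail.center_sub_trailVal_le_succ {X : Type*} {prec : X → X → Prop} {S : Set IType}
    {c : X → ℝ} {τ : X → IType} (h : SRep prec S c τ) {t : ℕ} {x : ℕ → X}
    (hx : ForcingTrail prec t x) {i : ℕ} (hi : i < t) :
    c (x i) - (trailVal prec x i : ℝ) ≤ c (x (i + 1)) - (trailVal prec x (i + 1) : ℝ) := by
  classical
  rw [trailVal, trailVal, Finset.sum_range_succ]
  by_cases hp : prec (x i) (x (i + 1))
  · have hc : c (x i) + 1 ≤ c (x (i + 1)) :=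
      ((h.2 _ _).1 hp).elim le_of_lt fun hc => hc.1.le
    rw [if_pos hp]
    push_cast
    linarith
  · have hc : c (x i) ≤ c (x (i + 1)) + 1 :=
      le_of_not_gt fun hc => ((hx i hi).resolve_left hp).2 ((h.2 _ _).2 (Or.inl hc))
    rw [if_neg hp]
    push_cast
    linarith

/-- Along a forcing trail, the center minus the value is nondecreasing. -/
theorem ForcingTrail.center_sub_trailVal_mono {X : Type*} {prec : X → X → Prop} {S : Set IType}
    {c : X → ℝ} {τ : X → IType} (h : SRep prec S c τ) {t : ℕ} {x : ℕ → X}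
    (hx : ForcingTrail prec t x) {i j : ℕ} (hij : i ≤ j) (hj : j ≤ t) :
    c (x i) - (trailVal prec x i : ℝ) ≤ c (x j) - (trailVal prec x j : ℝ) := by
  induction j, hij using Nat.le_induction with
  | base => exact le_rfl
  | succ k _ ih =>
    exact (ih (by omega)).trans (hx.center_sub_trailVal_le_succ h (by omega))

/-- lower bounds on centers along a forcing trail. -/
theorem stmt_2 {X : Type*} (prec : X → X → Prop)
    (hirr : ∀ x, ¬ prec x x)
    (htrans : ∀ x y z, prec x y → prec y z → prec x z)
    (c : X → ℝ) (τ : X → IType)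
    (h : SRep prec Set.univ c τ)
    (t : ℕ) (x : ℕ → X) (hx : ForcingTrail prec t x) :
    (∀ i ≤ t, c (x 0) + (trailVal prec x i : ℝ) ≤ c (x i)) ∧
    (∀ i ≤ t, c (x 0) + (trailVal prec x i : ℝ) < c (x i) →
      ∀ j, i ≤ j → j ≤ t → c (x 0) + (trailVal prec x j : ℝ) < c (x j)) := by
  refine ⟨fun i hi => ?_, fun i _ hlt j hij hj => ?_⟩
  · have hmono := hx.center_sub_trailVal_mono h (Nat.zero_le i) hi
    have hzero : trailVal prec x 0 = 0 := Finset.sum_range_zero _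
    rw [hzero, Int.cast_zero] at hmono
    linarith
  · linarith [hx.center_sub_trailVal_mono h hij hj]
end

section
/- If a poset P has a forcing cycle C with val(C) > 0, then P admits no {A,B,C,D}-representation; consequently P is not an S-order for any subset S of {A,B,C,D}. -/
/-- Along a forcing trail, the center grows by at least the value of the trail. -/
theorem SRep.trailVal_le {X : Type*} {prec : X → X → Prop} {S : Set IType} {c : X → ℝ}
    {τ : X → IType} (h : SRep prec S c τ) {t : ℕ} {x : ℕ → X} (hx : ForcingTrail prec t x) :
    (trailVal prec x t : ℝ) ≤ c (x t) - c (x 0) := by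
  rw [← Finset.sum_range_sub (fun i => c (x i)), trailVal, Int.cast_sum]
  refine Finset.sum_le_sum fun i hi => ?_
  split_ifs with hup
  · rcases (h.2 _ _).1 hup with hlt | ⟨heq, -⟩ <;> push_cast <;> linarith
  · have hside := ((hx i (Finset.mem_range.1 hi)).resolve_left hup).2
    have hle : ¬ c (x (i + 1)) + 1 < c (x i) := fun hlt => hside ((h.2 _ _).2 (Or.inl hlt))
    push_cast
    linarith

/-- a poset with a forcing cycle of positive value admits no
`{A,B,C,D}`-representation, hence is not an `S`-order for any `S`. -/
theorem stmt_3 {X : Type*} (prec : X → X → Prop)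
    (hirr : ∀ x, ¬ prec x x)
    (htrans : ∀ x y z, prec x y → prec y z → prec x z)
    (t : ℕ) (x : ℕ → X)
    (hx : ForcingTrail prec t x) (hcyc : x t = x 0)
    (hval : 0 < trailVal prec x t) :
    (¬ SOrder prec Set.univ) ∧ ∀ S : Set IType, ¬ SOrder prec S := by
  have key : ∀ S : Set IType, ¬ SOrder prec S := by
    rintro S ⟨c, τ, h⟩
    have hle := h.trailVal_le hx
    rw [hcyc, sub_self] at hle
    exact absurd hval (not_lt.2 (by exact_mod_cast hle))
  exact ⟨key _, key⟩
end

section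
/- Let P be a finite poset in which every nontrivial forcing cycle C has val(C) < 0. Then P is a unit interval order; consequently P admits an S-representation for every nonempty subset S of {A,B,C,D}. -/
section ForcingTrails

variable {X : Type*} {prec : X → X → Prop} {x y : ℕ → X} {t : ℕ}

lemma ForcingTrail.mono {s : ℕ} (hx : ForcingTrail prec t x) (hst : s ≤ t) :
    ForcingTrail prec s x :=
  fun i hi => hx i (hi.trans_le hst)

lemma ForcingTrail.shift {i : ℕ} (hx : ForcingTrail prec (i + t) x) :
    ForcingTrail prec t fun k => x (i + k) :=
  fun k hk => hx (i + k) (by omega)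

lemma ForcingTrail.congr (hx : ForcingTrail prec t x) (hxy : ∀ i ≤ t, x i = y i) :
    ForcingTrail prec t y := by
  intro i hi
  rw [← hxy i hi.le, ← hxy (i + 1) hi]
  exact hx i hi

/-- Concatenation of two trails. -/
lemma ForcingTrail.append {i r : ℕ} (hx : ForcingTrail prec i x)
    (hy : ForcingTrail prec r fun k => x (i + k)) : ForcingTrail prec (i + r) x := by
  intro k hk
  rcases lt_or_ge k i with hki | hki
  · exact hx k hki
  · obtain ⟨m, rfl⟩ := Nat.exists_eq_add_of_le hki
    exact hy m (by omega)

lemma trailVal_congr (hxy : ∀ i ≤ t, x i = y i) : trailVal prec x t = trailVal prec y t := by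
  refine Finset.sum_congr rfl fun i hi => ?_
  rw [Finset.mem_range] at hi
  rw [hxy i hi.le, hxy (i + 1) hi]

lemma trailVal_add (prec : X → X → Prop) (x : ℕ → X) (i r : ℕ) :
    trailVal prec x (i + r) = trailVal prec x i + trailVal prec (fun k => x (i + k)) r :=
  Finset.sum_range_add _ _ _

lemma trailVal_le (prec : X → X → Prop) (x : ℕ → X) (t : ℕ) : trailVal prec x t ≤ t := by
  classical
  have h := Finset.sum_le_card_nsmul (Finset.range t)
    (fun j => if prec (x j) (x (j + 1)) then (1 : ℤ) else -1) 1
    fun j _ => by split_ifs <;> norm_num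
  simpa [trailVal] using h

open scoped Classical in
lemma trailVal_one (prec : X → X → Prop) (x : ℕ → X) :
    trailVal prec x 1 = if prec (x 0) (x 1) then 1 else -1 := by
  simp [trailVal]

/-- Remove the `d` steps of the sequence `x` that follow position `i`. -/
def excise (x : ℕ → X) (i d k : ℕ) : X := if k ≤ i then x k else x (k + d)

lemma excise_of_le {i d k : ℕ} (hk : k ≤ i) : excise x i d k = x k := if_pos hk

lemma excise_add {i d : ℕ} (hd : x (i + d) = x i) (k : ℕ) :
    excise x i d (i + k) = x (i + d + k) := by
  rcases Nat.eq_zero_or_pos k with rfl | hk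
  · simp [excise, hd]
  · rw [excise, if_neg (by omega), add_right_comm]

lemma ForcingTrail.excise {i d r : ℕ} (hx : ForcingTrail prec (i + d + r) x)
    (hd : x (i + d) = x i) : ForcingTrail prec (i + r) (excise x i d) := by
  refine .append ((hx.mono (by omega : i ≤ _)).congr fun k hk => (excise_of_le hk).symm) ?_
  exact hx.shift.congr fun k _ => (excise_add hd k).symm

lemma trailVal_excise {i d : ℕ} (hd : x (i + d) = x i) (r : ℕ) :
    trailVal prec x (i + d + r) =
      trailVal prec (excise x i d) (i + r) + trailVal prec (fun k => x (i + k)) d := by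
  rw [trailVal_add, trailVal_add, trailVal_add, trailVal_congr (fun k hk => excise_of_le hk),
    trailVal_congr (fun k _ => excise_add hd k)]
  ring

/-- If every nontrivial forcing cycle has negative value, then the values of forcing trails,
perturbed by a small positive amount per step, are bounded above. -/
lemma trailVal_add_mul_le [Finite X]
    (h : ∀ (t : ℕ) (x : ℕ → X), 1 ≤ t → ForcingTrail prec t x → x t = x 0 →
      trailVal prec x t < 0)
    {ε : ℝ} (hε : 0 < ε) (hε' : ε * Nat.card X ≤ 1) (t : ℕ) :
    ∀ x : ℕ → X, ForcingTrail prec t x →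
      trailVal prec x t + ε * t ≤ Nat.card X + 1 := by
  induction t using Nat.strong_induction_on with
  | _ t ih =>
    intro x hx
    rcases le_or_gt t (Nat.card X) with ht | ht
    · have h₁ : (trailVal prec x t : ℝ) ≤ t := by exact_mod_cast trailVal_le prec x t
      have h₂ : (t : ℝ) ≤ Nat.card X := by exact_mod_cast ht
      nlinarith
    · obtain ⟨i, d, hd, hn, hid⟩ :
          ∃ i d, 1 ≤ d ∧ i + d ≤ Nat.card X ∧ x (i + d) = x i := by
        have := Fintype.ofFinite X
        obtain ⟨a, b, hab, heq⟩ := Fintype.exists_ne_map_eq_of_card_lt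
          (fun k : Fin (Nat.card X + 1) => x k) (by simp [Nat.card_eq_fintype_card])
        have hab' : (a : ℕ) ≠ b := fun e => hab (Fin.ext e)
        rcases lt_or_gt_of_ne hab' with hlt | hlt
        · exact ⟨a, b - a, by omega, by omega, by rw [Nat.add_sub_cancel' hlt.le]; exact heq.symm⟩
        · exact ⟨b, a - b, by omega, by omega, by rw [Nat.add_sub_cancel' hlt.le]; exact heq⟩
      obtain ⟨r, rfl⟩ := Nat.exists_eq_add_of_le (hn.trans ht.le)
      have hcyc := h d (fun k => x (i + k)) hd (hx.mono (by omega : i + d ≤ _)).shift hid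
      have hrest := ih (i + r) (by omega) _ (hx.excise hid)
      have hcyc' : (trailVal prec (fun k => x (i + k)) d : ℝ) ≤ -1 := by
        exact_mod_cast Int.le_sub_one_of_lt hcyc
      have hd' : (d : ℝ) ≤ Nat.card X := by exact_mod_cast (by omega : d ≤ Nat.card X)
      rw [trailVal_excise hid]
      push_cast at hrest ⊢
      nlinarith

/-- The vertex potential with strict gaps obtained from the values of forcing trails. -/
lemma exists_potential [Finite X]
    (h : ∀ (t : ℕ) (x : ℕ → X), 1 ≤ t → ForcingTrail prec t x → x t = x 0 →
      trailVal prec x t < 0) :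
    ∃ f : X → ℝ, ∀ a b, (prec a b → f a + 1 < f b) ∧ (¬ prec a b → f b < f a + 1) := by
  classical
  obtain ⟨ε, hε, hε'⟩ : ∃ ε : ℝ, 0 < ε ∧ ε * Nat.card X ≤ 1 := by
    refine ⟨1 / (Nat.card X + 1), by positivity, ?_⟩
    rw [one_div_mul_eq_div, div_le_one (by positivity)]
    linarith
  let V : X → Set ℝ := fun a =>
    {w | ∃ t x, ForcingTrail prec t x ∧ x t = a ∧ w = trailVal prec x t + ε * t}
  have hbdd (a : X) : BddAbove (V a) := by
    refine ⟨Nat.card X + 1, ?_⟩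
    rintro _ ⟨t, x, hx, -, rfl⟩
    exact trailVal_add_mul_le h hε hε' t x hx
  have hne (a : X) : (V a).Nonempty := ⟨_, 0, fun _ => a, fun i hi => absurd hi (by omega), rfl, rfl⟩
  have hstep {a b : X} (hab : prec a b ∨ Incomp prec a b) :
      sSup (V a) + (if prec a b then 1 else -1) + ε ≤ sSup (V b) := by
    suffices sSup (V a) ≤ sSup (V b) - (if prec a b then 1 else -1) - ε by linarith
    refine csSup_le (hne a) ?_
    rintro _ ⟨t, x, hx, rfl, rfl⟩
    let y : ℕ → X := fun k => if k ≤ t then x k else b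
    have hyx : ∀ k ≤ t, x k = y k := fun k hk => (if_pos hk).symm
    have hyt : y t = x t := (hyx t le_rfl).symm
    have hyb : y (t + 1) = b := if_neg (by omega)
    have hy : ForcingTrail prec (t + 1) y := by
      refine (hx.congr hyx).append fun k hk => ?_
      obtain rfl : k = 0 := by omega
      simpa [hyt, hyb] using hab
    have hle := le_csSup (hbdd b) ⟨t + 1, y, hy, hyb, rfl⟩
    rw [trailVal_add, trailVal_one, ← trailVal_congr hyx] at hle
    simp only [add_zero, hyt, hyb] at hle
    push_cast at hle
    linarith
  refine ⟨fun a => sSup (V a), fun a b => ⟨fun hab => ?_, fun hab => ?_⟩⟩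
  · have := hstep (.inl hab)
    rw [if_pos hab] at this
    linarith
  · by_cases hba : prec b a
    · have := hstep (.inl hba)
      rw [if_pos hba] at this
      linarith
    · have := hstep (a := b) (b := a) (.inr ⟨hba, hab⟩)
      rw [if_neg hba] at this
      linarith

end ForcingTrails

/-- if every nontrivial forcing cycle has negative value, then the finite poset
is a unit interval order, hence an `S`-order for every nonempty `S`. -/
theorem stmt_4 {X : Type*} [Finite X] (prec : X → X → Prop)
    (hirr : ∀ x, ¬ prec x x)
    (htrans : ∀ x y z, prec x y → prec y z → prec x z)
    (h : ∀ (t : ℕ) (x : ℕ → X), 1 ≤ t → ForcingTrail prec t x → x t = x 0 →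
      trailVal prec x t < 0) :
    UnitIntervalOrder prec ∧ ∀ S : Set IType, S.Nonempty → SOrder prec S := by
  obtain ⟨f, hf⟩ := exists_potential h
  refine ⟨⟨f, fun x y => ⟨(hf x y).1, fun hxy => ?_⟩⟩, ?_⟩
  · by_contra hn
    exact hxy.not_gt ((hf x y).2 hn)
  · rintro S ⟨s, hs⟩
    refine ⟨f, fun _ => s, fun _ => hs, fun x y => ⟨fun hxy => .inl ((hf x y).1 hxy), fun hxy => ?_⟩⟩
    by_contra hn
    have := (hf x y).2 hn
    rcases hxy with hlt | ⟨heq, -⟩ <;> linarith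
end

section
/- A finite poset admits a {B,C}-representation if and only if it is a unit interval order. -/
open Filter Topology in
/-- Finitely many differences that exceed `1` are bounded below by some `m > 1`. -/
theorem exists_one_lt_le_sub {X : Type*} [Finite X] (f : X → ℝ) :
    ∃ m : ℝ, 1 < m ∧ ∀ x y, 1 < f y - f x → m ≤ f y - f x := by
  have h : ∀ᶠ m in 𝓝[>] (1 : ℝ), ∀ x y, 1 < f y - f x → m ≤ f y - f x := by
    simp only [eventually_all]
    exact fun x y h => mem_nhdsWithin_of_mem_nhds (Iic_mem_nhds h)
  exact (eventually_mem_nhdsWithin.and h).exists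

open Filter Topology in
/-- Finitely many differences below `1` are bounded above by some positive `m < 1`. -/
theorem exists_lt_one_sub_le {X : Type*} [Finite X] (f : X → ℝ) :
    ∃ m : ℝ, 0 < m ∧ m < 1 ∧ ∀ x y, f y - f x < 1 → f y - f x ≤ m := by
  have h : ∀ᶠ m in 𝓝[<] (1 : ℝ), ∀ x y, f y - f x < 1 → f y - f x ≤ m := by
    simp only [eventually_all]
    exact fun x y h => mem_nhdsWithin_of_mem_nhds (Ici_mem_nhds h)
  have hpos : ∀ᶠ m in 𝓝[<] (1 : ℝ), 0 < m :=
    mem_nhdsWithin_of_mem_nhds (Ioi_mem_nhds one_pos)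
  exact (hpos.and (eventually_mem_nhdsWithin.and h)).exists

/-- Every pair of types from `{B, C}` satisfies `typeComp`. -/
theorem typeComp_of_mem_BC {s t : IType} (hs : s ∈ ({IType.B, IType.C} : Set IType))
    (ht : t ∈ ({IType.B, IType.C} : Set IType)) : typeComp s t := by
  rcases hs with rfl | rfl <;> rcases ht with rfl | rfl <;> simp [typeComp]

/-- a finite poset admits a `{B,C}`-representation iff it is a unit
interval order. -/
theorem stmt_7 {X : Type*} [Finite X] (prec : X → X → Prop)
    (hirr : ∀ x, ¬ prec x x)
    (htrans : ∀ x y z, prec x y → prec y z → prec x z) :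
    SOrder prec {IType.B, IType.C} ↔ UnitIntervalOrder prec := by
  constructor
  · rintro ⟨c, τ, hτ, h⟩
    obtain ⟨m, hm0, hm1, hm⟩ := exists_lt_one_sub_le c
    refine ⟨fun x => c x / m, fun x y => ?_⟩
    have hcomp := typeComp_of_mem_BC (hτ x) (hτ y)
    rw [h, and_iff_left hcomp, ← le_iff_lt_or_eq, ← lt_sub_iff_add_lt', ← sub_div,
      lt_div_iff₀ hm0, one_mul]
    exact ⟨fun hle => by linarith, fun hlt => by linarith [not_lt.1 (mt (hm x y) hlt.not_ge)]⟩
  · rintro ⟨f, h⟩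
    obtain ⟨m, hm1, hm⟩ := exists_one_lt_le_sub f
    refine ⟨fun x => f x / m, fun _ => IType.B, fun _ => Or.inl rfl, fun x y => ?_⟩
    have hcomp : typeComp IType.B IType.B := Or.inl rfl
    rw [h, and_iff_left hcomp, ← le_iff_lt_or_eq, ← le_sub_iff_add_le', ← sub_div,
      le_div_iff₀ (one_pos.trans hm1), one_mul, ← lt_sub_iff_add_lt']
    exact ⟨hm x y, hm1.trans_le⟩
end

section
/- Let P be a finite twin-free poset admitting an {A,B}-representation. Then P contains no induced copy of any of the following posets: 2+2, 4+1, 3+1+1, Z, D, Y, or the dual of Y. -/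
theorem typeComp_iff {s t : IType} (hs : s ∈ ({IType.A, IType.B} : Set IType))
    (ht : t ∈ ({IType.A, IType.B} : Set IType)) :
    typeComp s t ↔ ¬ (s = IType.A ∧ t = IType.A) := by
  rcases hs with rfl | rfl <;> rcases ht with rfl | rfl <;> simp [typeComp]

section ABRepresentation

variable {X : Type*} {prec : X → X → Prop} {c : X → ℝ} {τ : X → IType}

theorem SRep.le_of_prec {S : Set IType} (h : SRep prec S c τ) {x y : X} (hxy : prec x y) :
    c x + 1 ≤ c y := by
  rcases (h.2 x y).1 hxy with h | h
  exacts [h.le, h.1.le]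

theorem SRep.le_of_not_prec {S : Set IType} (h : SRep prec S c τ) {x y : X}
    (hxy : ¬ prec x y) : c y ≤ c x + 1 :=
  not_lt.1 fun hlt => hxy ((h.2 x y).2 (Or.inl hlt))

theorem SRep.prec_iff_of_eq {S : Set IType} (h : SRep prec S c τ) {x y : X}
    (hxy : c x + 1 = c y) : prec x y ↔ typeComp (τ x) (τ y) := by
  rw [h.2 x y]
  simp [hxy]

/-- In a twin-free poset, an element is determined by its center and type. -/
theorem SRep.eq_of_twinFree {S : Set IType} (h : SRep prec S c τ) (htf : TwinFree prec)
    {x y : X} (hc : c x = c y) (hτ : τ x = τ y) : x = y := by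
  by_contra hne
  refine htf x y ⟨hne, ⟨fun hp => ?_, fun hp => ?_⟩, fun z _ _ => ⟨?_, ?_⟩⟩
  · linarith [h.le_of_prec hp]
  · linarith [h.le_of_prec hp]
  · rw [h.2, h.2, hc, hτ]
  · rw [h.2, h.2, hc, hτ]

/-- The centers and types in an `{A,B}`-representation of an induced `3+1` are forced. -/
theorem SRep.of_chain_incomp (h : SRep prec {IType.A, IType.B} c τ) {x y z v : X}
    (hxy : prec x y) (hyz : prec y z) (hxv : ¬ prec x v) (hvz : ¬ prec v z) :
    c x = c v - 1 ∧ c y = c v ∧ c z = c v + 1 ∧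
      τ x = IType.A ∧ τ y = IType.B ∧ τ z = IType.A ∧ τ v = IType.A := by
  have h₁ := h.le_of_prec hxy
  have h₂ := h.le_of_prec hyz
  have h₃ := h.le_of_not_prec hxv
  have h₄ := h.le_of_not_prec hvz
  rw [h.prec_iff_of_eq (by linarith), typeComp_iff (h.1 _) (h.1 _)] at hxy hxv hvz
  have hx : τ x = IType.A := by tauto
  have hy : τ y = IType.B := (h.1 y).resolve_left fun hy => hxy ⟨hx, hy⟩
  exact ⟨by linarith, by linarith, by linarith, hx, hy, by tauto, by tauto⟩

theorem SRep.not_two_add_two (h : SRep prec {IType.A, IType.B} c τ) {a b p q : X}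
    (hab : prec a b) (hpq : prec p q) (haq : ¬ prec a q) (hpb : ¬ prec p b) : False := by
  have h₁ := h.le_of_prec hab
  have h₂ := h.le_of_prec hpq
  have h₃ := h.le_of_not_prec haq
  have h₄ := h.le_of_not_prec hpb
  rw [h.prec_iff_of_eq (by linarith), typeComp_iff (h.1 _) (h.1 _)] at hab haq hpb
  tauto

end ABRepresentation

/-- a finite twin-free poset with an `{A,B}`-representation contains no
induced copy of `2+2`, `4+1`, `3+1+1`, `Z`, `D`, `Y`, or the dual of `Y`. -/
theorem stmt_9 {X : Type*} [Finite X] (prec : X → X → Prop)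
    (hirr : ∀ x, ¬ prec x x)
    (htrans : ∀ x y z, prec x y → prec y z → prec x z)
    (htf : TwinFree prec)
    (hAB : SOrder prec {IType.A, IType.B}) :
    ¬ ContainsInduced prec rel2p2 ∧
    ¬ ContainsInduced prec rel4p1 ∧
    ¬ ContainsInduced prec rel3p1p1 ∧
    ¬ ContainsInduced prec relZ ∧
    ¬ ContainsInduced prec relD ∧
    ¬ ContainsInduced prec relY ∧
    ¬ ContainsInduced prec (fun i j => relY j i) := by
  obtain ⟨c, τ, h⟩ := hAB
  refine ⟨?_, ?_, ?_, ?_, ?_, ?_, ?_⟩ <;> rintro ⟨f, hf, hr⟩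
  · exact h.not_two_add_two (a := f 0) (b := f 1) (p := f 2) (q := f 3)
      ((hr _ _).1 (by simp [rel2p2])) ((hr _ _).1 (by simp [rel2p2]))
      (mt (hr _ _).2 (by simp [rel2p2])) (mt (hr _ _).2 (by simp [rel2p2]))
  · have h₁ := h.le_of_prec ((hr 0 1).1 (by simp [rel4p1]))
    have h₂ := h.le_of_prec ((hr 1 2).1 (by simp [rel4p1]))
    have h₃ := h.le_of_prec ((hr 2 3).1 (by simp [rel4p1]))
    have h₄ := h.le_of_not_prec (mt (hr 0 4).2 (by simp [rel4p1]))
    have h₅ := h.le_of_not_prec (mt (hr 4 3).2 (by simp [rel4p1]))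
    linarith
  · have chain (i : Fin 5) (hi : ¬ rel3p1p1 0 i) (hi' : ¬ rel3p1p1 i 2) :=
      h.of_chain_incomp ((hr 0 1).1 (by simp [rel3p1p1])) ((hr 1 2).1 (by simp [rel3p1p1]))
        (mt (hr 0 i).2 hi) (mt (hr i 2).2 hi')
    obtain ⟨-, hu, -, -, -, -, hu'⟩ := chain 3 (by simp [rel3p1p1]) (by simp [rel3p1p1])
    obtain ⟨-, hv, -, -, -, -, hv'⟩ := chain 4 (by simp [rel3p1p1]) (by simp [rel3p1p1])
    exact absurd (hf (h.eq_of_twinFree htf (hu.symm.trans hv) (hu'.trans hv'.symm))) (by decide)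
  · obtain ⟨-, -, -, -, hz, -, -⟩ := h.of_chain_incomp ((hr 1 2).1 (by simp [relZ]))
      ((hr 2 3).1 (by simp [relZ])) (mt (hr 1 5).2 (by simp [relZ]))
      (mt (hr 5 3).2 (by simp [relZ]))
    obtain ⟨-, -, -, -, -, hz', -⟩ := h.of_chain_incomp ((hr 0 1).1 (by simp [relZ]))
      ((hr 1 2).1 (by simp [relZ])) (mt (hr 0 4).2 (by simp [relZ]))
      (mt (hr 4 2).2 (by simp [relZ]))
    simp [hz] at hz'
  · have chain (i : Fin 5) (hi : relD 0 i) (hi' : relD i 3) :=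
      h.of_chain_incomp ((hr 0 i).1 hi) ((hr i 3).1 hi') (mt (hr 0 4).2 (by simp [relD]))
        (mt (hr 4 3).2 (by simp [relD]))
    obtain ⟨-, hy, -, -, hy', -, -⟩ := chain 1 (by simp [relD]) (by simp [relD])
    obtain ⟨-, hw, -, -, hw', -, -⟩ := chain 2 (by simp [relD]) (by simp [relD])
    exact absurd (hf (h.eq_of_twinFree htf (hy.trans hw.symm) (hy'.trans hw'.symm))) (by decide)
  · have chain (i : Fin 5) (hi : relY 1 i) (hi' : ¬ relY 4 i) :=
      h.of_chain_incomp ((hr 0 1).1 (by simp [relY])) ((hr 1 i).1 hi)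
        (mt (hr 0 4).2 (by simp [relY])) (mt (hr 4 i).2 hi')
    obtain ⟨-, -, hz, -, -, hz', -⟩ := chain 2 (by simp [relY]) (by simp [relY])
    obtain ⟨-, -, hw, -, -, hw', -⟩ := chain 3 (by simp [relY]) (by simp [relY])
    exact absurd (hf (h.eq_of_twinFree htf (hz.trans hw.symm) (hz'.trans hw'.symm))) (by decide)
  · have chain (i : Fin 5) (hi : relY 1 i) (hi' : ¬ relY 4 i) :=
      h.of_chain_incomp ((hr i 1).1 hi) ((hr 1 0).1 (by simp [relY]))
        (mt (hr i 4).2 hi') (mt (hr 4 0).2 (by simp [relY]))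
    obtain ⟨hz, -, -, hz', -, -, -⟩ := chain 2 (by simp [relY]) (by simp [relY])
    obtain ⟨hw, -, -, hw', -, -, -⟩ := chain 3 (by simp [relY]) (by simp [relY])
    exact absurd (hf (h.eq_of_twinFree htf (hz.trans hw.symm) (hz'.trans hw'.symm))) (by decide)
end

section
/- Every finite poset that admits a {C,D}-representation and contains no induced copy of 2+2 admits an {A,B}-representation and an {A,C}-representation. -/
theorem exists_shift_increment (S : Finset ℝ) (w : ℝ → ℝ) :
    ∃ h : ℝ → ℝ, ∀ r ∈ S, h (r + 1) = h r + w r := by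
  classical
  refine ⟨fun r => ∑ s ∈ S with ∃ n : ℕ, r = s + 1 + n, w s, fun r hr => ?_⟩
  have key : (S.filter fun s => ∃ n : ℕ, r + 1 = s + 1 + n) =
      insert r (S.filter fun s => ∃ n : ℕ, r = s + 1 + n) := by
    ext s
    simp only [Finset.mem_filter, Finset.mem_insert]
    constructor
    · rintro ⟨hs, n, hn⟩
      rcases n with _ | n
      · left
        push_cast at hn
        linarith
      · exact Or.inr ⟨hs, n, by push_cast at hn; linarith⟩
    · rintro (rfl | ⟨hs, n, hn⟩)
      · exact ⟨hr, 0, by simp⟩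
      · exact ⟨hs, n + 1, by push_cast; linarith⟩
  have hnot : r ∉ S.filter fun s => ∃ n : ℕ, r = s + 1 + n := by
    simp only [Finset.mem_filter, not_and, not_exists]
    intro _ n hn
    have := n.cast_nonneg (α := ℝ)
    linarith
  simp only [key, Finset.sum_insert hnot]
  ring

theorem exists_small_perturbation {X : Type*} [Finite X] (c δ : X → ℝ) :
    ∃ ε : ℝ, 0 < ε ∧ ∀ x y,
      (c x + 1 < c y → c x + ε * δ x + 1 < c y + ε * δ y) ∧
      (c y < c x + 1 → c y + ε * δ y < c x + ε * δ x + 1) := by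
  have key : ∀ a b p q : ℝ, a < b → ∀ᶠ ε in nhdsWithin (0 : ℝ) (Set.Ioi 0),
      a + ε * p < b + ε * q := by
    intro a b p q hab
    have h : ∀ᶠ ε in nhds (0 : ℝ), a + ε * p < b + ε * q :=
      ContinuousAt.eventually_lt (by fun_prop) (by fun_prop) (by simpa using hab)
    exact h.filter_mono nhdsWithin_le_nhds
  have hall : ∀ᶠ ε in nhdsWithin (0 : ℝ) (Set.Ioi 0), ∀ x y,
      (c x + 1 < c y → c x + ε * δ x + 1 < c y + ε * δ y) ∧
      (c y < c x + 1 → c y + ε * δ y < c x + ε * δ x + 1) := by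
    simp only [Filter.eventually_all, Filter.eventually_and]
    intro x y
    constructor
    · intro h
      filter_upwards [key _ _ (δ x) (δ y) h] with ε hε
      linarith
    · intro h
      filter_upwards [key _ _ (δ y) (δ x) h] with ε hε
      linarith
  obtain ⟨ε, hε, hpos⟩ := (hall.and self_mem_nhdsWithin).exists
  exact ⟨ε, hpos, hε⟩

theorem SOrder.of_perturbation {X : Type*} [Finite X] {prec : X → X → Prop} {S : Set IType}
    (c δ : X → ℝ) (τ : X → IType) (hτ : ∀ x, τ x ∈ S)
    (hlt : ∀ x y, c x + 1 < c y → prec x y)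
    (hgt : ∀ x y, c y < c x + 1 → ¬ prec x y)
    (heq : ∀ x y, c x + 1 = c y →
      (prec x y ↔ (δ x < δ y ∨ (δ x = δ y ∧ typeComp (τ x) (τ y))))) :
    SOrder prec S := by
  obtain ⟨ε, hε, hall⟩ := exists_small_perturbation c δ
  refine ⟨fun x => c x + ε * δ x, τ, hτ, fun x y => ?_⟩
  rcases lt_trichotomy (c x + 1) (c y) with h | h | h
  · simp only [hlt x y h, (hall x y).1 h, true_or]
  · have e1 : c x + ε * δ x + 1 < c y + ε * δ y ↔ δ x < δ y := by
      refine Iff.trans ?_ (mul_lt_mul_iff_right₀ hε)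
      constructor <;> intro <;> linarith
    have e2 : c x + ε * δ x + 1 = c y + ε * δ y ↔ δ x = δ y := by
      refine Iff.trans ?_ (mul_right_inj' hε.ne')
      constructor <;> intro <;> linarith
    rw [heq x y h, e1, e2]
  · have h' := (hall x y).2 h
    simp only [hgt x y h, h'.not_gt, h'.ne', false_or, false_and]

/-- `x` shares its centre with an element of the other type. -/
def IsMixed {X : Type*} (c : X → ℝ) (b : X → Bool) (x : X) : Prop :=
  ∃ y, c y = c x ∧ b y ≠ b x

theorem containsInduced_rel2p2_of_isMixed {X : Type*} {prec : X → X → Prop}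
    {c : X → ℝ} {b : X → Bool}
    (hrep : ∀ x y, prec x y ↔ (c x + 1 < c y ∨ (c x + 1 = c y ∧ b x = b y)))
    {x y : X} (hxy : c x + 1 = c y) (hx : IsMixed c b x) (hy : IsMixed c b y) :
    ContainsInduced prec rel2p2 := by
  obtain ⟨x', hcx, hbx⟩ := hx
  obtain ⟨y₁, y₂, h1, h2, hb1, hb2⟩ :
      ∃ y₁ y₂, c y₁ = c y ∧ c y₂ = c y ∧ b y₁ = b x ∧ b y₂ = b x' := by
    obtain ⟨y', hcy, hby⟩ := hy
    by_cases h : b y = b x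
    · exact ⟨y, y', rfl, hcy, h, by rw [Bool.eq_not.2 hby, Bool.eq_not.2 hbx, h]⟩
    · exact ⟨y', y, hcy, rfl, by simp [Bool.eq_not.2 hby, Bool.eq_not.2 h],
        by rw [Bool.eq_not.2 h, Bool.eq_not.2 hbx]⟩
  have hiff : ∀ i j, rel2p2 i j ↔ prec (![x, y₁, x', y₂] i) (![x, y₁, x', y₂] j) := by
    intro i j
    rw [hrep]
    fin_cases i <;> fin_cases j <;> simp [rel2p2] <;> grind
  refine ⟨![x, y₁, x', y₂], fun i j hij => ?_, hiff⟩
  fin_cases i <;> fin_cases j <;> simp at hij ⊢ <;> grind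

theorem exists_offset {X : Type*} [Finite X] (c : X → ℝ) (b : X → Bool) :
    ∃ (δ : X → ℝ) (matched : X → Prop), ∀ x y, c x + 1 = c y →
      (¬ IsMixed c b x → ¬ IsMixed c b y → if b x = b y then δ x < δ y else δ y < δ x) ∧
      (¬ IsMixed c b x → IsMixed c b y →
        if b x = b y then δ x < δ y ∨ δ x = δ y ∧ matched y
        else δ y < δ x ∨ δ x = δ y ∧ ¬ matched y) ∧
      (IsMixed c b x → ¬ IsMixed c b y →
        if b x = b y then δ x < δ y ∨ δ x = δ y ∧ matched x
        else δ y < δ x ∨ δ x = δ y ∧ ¬ matched x) := by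
  classical
  cases nonempty_fintype X
  let w : ℝ → ℝ := fun r =>
    if ∃ x y, c x = r ∧ c y = r + 1 ∧ ¬ IsMixed c b x ∧ ¬ IsMixed c b y then
      if ∃ x y, c x = r ∧ c y = r + 1 ∧ b x = b y then 1 else -1
    else 0
  obtain ⟨h, hh⟩ := exists_shift_increment (Finset.univ.image c) w
  let prevEq : X → Prop := fun x => ∃ p, c p + 1 = c x ∧ b p = b x
  let prevNe : X → Prop := fun x => ∃ p, c p + 1 = c x ∧ b p ≠ b x
  let nextEq : X → Prop := fun x => ∃ p, c x + 1 = c p ∧ b p = b x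
  let nextNe : X → Prop := fun x => ∃ p, c x + 1 = c p ∧ b p ≠ b x
  let adj : X → ℝ := fun x =>
    if IsMixed c b x then
      if prevEq x ∧ nextNe x then 1 else if prevNe x ∧ nextEq x then -1 else 0
    else 0
  have pure_eq : ∀ x y, c x = c y → ¬ IsMixed c b y → b x = b y := by
    intro x y hc hy
    by_contra hb
    exact hy ⟨x, hc, hb⟩
  refine ⟨fun x => h (c x) + adj x, fun x => prevEq x ∨ nextEq x, fun x y hxy => ?_⟩
  have hstep : h (c y) = h (c x) + w (c x) := by
    rw [← hxy]
    exact hh _ (by simp)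
  refine ⟨fun hx hy => ?_, fun hx hy => ?_, fun hx hy => ?_⟩
  · have hw : w (c x) = if b x = b y then 1 else -1 := by
      have h1 : ∃ x' y', c x' = c x ∧ c y' = c x + 1 ∧ ¬ IsMixed c b x' ∧ ¬ IsMixed c b y' :=
        ⟨x, y, rfl, hxy.symm, hx, hy⟩
      have h2 : (∃ x' y', c x' = c x ∧ c y' = c x + 1 ∧ b x' = b y') ↔ b x = b y := by
        constructor
        · rintro ⟨x', y', hx', hy', hb⟩
          rw [← pure_eq x' x hx' hx, hb, pure_eq y' y (hy'.trans hxy) hy]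
        · exact fun hb => ⟨x, y, rfl, hxy.symm, hb⟩
      simp only [w, if_pos h1, h2]
    simp only [adj, if_neg hx, if_neg hy, hstep, hw]
    split_ifs <;> linarith
  · have hw : w (c x) = 0 := by
      refine if_neg ?_
      rintro ⟨x', y', -, hy', -, hm⟩
      obtain ⟨z, hz, hzb⟩ := hy
      have e1 := pure_eq z y' (by linarith) hm
      have e2 := pure_eq y y' (by linarith) hm
      exact hzb (e1.trans e2.symm)
    simp only [adj, if_neg hx, if_pos hy, hstep, hw]
    by_cases hb : b x = b y
    · have hp : prevEq y := ⟨x, hxy, hb⟩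
      have hn : ¬ prevNe y := by
        rintro ⟨p, hp, hpb⟩
        exact hpb ((pure_eq p x (by linarith) hx).trans hb)
      by_cases hq : nextNe y <;> simp [hb, hp, hn, hq]
    · have hp : prevNe y := ⟨x, hxy, hb⟩
      have hn : ¬ prevEq y := by
        rintro ⟨p, hp, hpb⟩
        exact hb ((pure_eq p x (by linarith) hx).symm.trans hpb)
      by_cases hq : nextEq y <;> simp [hb, hp, hn, hq]
  · have hw : w (c x) = 0 := by
      refine if_neg ?_
      rintro ⟨x', y', hx', -, hm, -⟩
      obtain ⟨z, hz, hzb⟩ := hx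
      have e1 := pure_eq z x' (by linarith) hm
      have e2 := pure_eq x x' (by linarith) hm
      exact hzb (e1.trans e2.symm)
    simp only [adj, if_pos hx, if_neg hy, hstep, hw]
    by_cases hb : b x = b y
    · have hp : nextEq x := ⟨y, hxy, hb.symm⟩
      have hn : ¬ nextNe x := by
        rintro ⟨p, hp, hpb⟩
        exact hpb ((pure_eq p y (by linarith) hy).trans hb.symm)
      by_cases hq : prevNe x <;> simp [hb, hp, hn, hq]
    · have hp : nextNe x := ⟨y, hxy, Ne.symm hb⟩
      have hn : ¬ nextEq x := by
        rintro ⟨p, hp, hpb⟩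
        exact hb (hpb.symm.trans (pure_eq p y (by linarith) hy))
      by_cases hq : prevEq x <;> simp [hb, hp, hn, hq]

theorem exists_bool_rep {X : Type*} {prec : X → X → Prop}
    (hCD : SOrder prec {IType.C, IType.D}) :
    ∃ (c : X → ℝ) (b : X → Bool),
      ∀ x y, prec x y ↔ (c x + 1 < c y ∨ (c x + 1 = c y ∧ b x = b y)) := by
  obtain ⟨c, τ, hτ, hrep⟩ := hCD
  refine ⟨c, fun x => decide (τ x = IType.C), fun x y => ?_⟩
  rw [hrep]
  have hx := hτ x
  have hy := hτ y
  simp only [Set.mem_insert_iff, Set.mem_singleton_iff] at hx hy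
  rcases hx with hx | hx <;> rcases hy with hy | hy <;> simp [hx, hy, typeComp]

/-- a finite `{C,D}`-order with no induced `2+2` is an `{A,B}`-order and an
`{A,C}`-order. -/
theorem stmt_10 {X : Type*} [Finite X] (prec : X → X → Prop)
    (hirr : ∀ x, ¬ prec x x)
    (htrans : ∀ x y z, prec x y → prec y z → prec x z)
    (hCD : SOrder prec {IType.C, IType.D})
    (h2p2 : ¬ ContainsInduced prec rel2p2) :
    SOrder prec {IType.A, IType.B} ∧ SOrder prec {IType.A, IType.C} := by
  classical
  obtain ⟨c, b, hrep⟩ := exists_bool_rep hCD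
  have hmix : ∀ x y, c x + 1 = c y → IsMixed c b x → ¬ IsMixed c b y := fun x y hxy hx hy =>
    h2p2 (containsInduced_rel2p2_of_isMixed hrep hxy hx hy)
  obtain ⟨δ, matched, hδ⟩ := exists_offset c b
  have hlt : ∀ x y, c x + 1 < c y → prec x y := fun x y h => (hrep x y).2 (Or.inl h)
  have hgt : ∀ x y, c y < c x + 1 → ¬ prec x y := fun x y h => by
    simp [hrep, h.not_gt, h.ne']
  have htie : ∀ x y, c x + 1 = c y → (prec x y ↔ b x = b y) := fun x y h => by
    simp [hrep, h]
  constructor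
  · refine SOrder.of_perturbation c δ
      (fun x => if IsMixed c b x ∧ matched x then IType.B else IType.A)
      (fun x => by split_ifs <;> simp) hlt hgt fun x y hxy => ?_
    have h := hδ x y hxy
    have hm := hmix x y hxy
    rw [htie x y hxy]
    clear hδ hmix hlt hgt htie hrep hirr htrans
    by_cases hx : IsMixed c b x <;> by_cases hy : IsMixed c b y <;>
      by_cases hb : b x = b y <;> by_cases hmx : matched x <;> by_cases hmy : matched y <;>
      simp [hx, hy, hb, hmx, hmy, typeComp] at h hm ⊢ <;> grind
  · refine SOrder.of_perturbation c δ
      (fun x => if IsMixed c b x ∧ ¬ matched x then IType.A else IType.C)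
      (fun x => by split_ifs <;> simp) hlt hgt fun x y hxy => ?_
    have h := hδ x y hxy
    have hm := hmix x y hxy
    rw [htie x y hxy]
    clear hδ hmix hlt hgt htie hrep hirr htrans
    by_cases hx : IsMixed c b x <;> by_cases hy : IsMixed c b y <;>
      by_cases hb : b x = b y <;> by_cases hmx : matched x <;> by_cases hmy : matched y <;>
      simp [hx, hy, hb, hmx, hmy, typeComp] at h hm ⊢ <;> grind
end

section
/- Every finite poset that admits an {A,C}-representation and contains no induced copy of the poset Z admits an {A,B}-representation and a {C,D}-representation. -/
/-- `c` and `P` encode an `{A,C}`-representation of `prec` in which `P` holds exactly at the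
elements of type `C`. -/
def ACCenters {X : Type*} (prec : X → X → Prop) (c : X → ℝ) (P : X → Prop) : Prop :=
  ∀ x y, prec x y ↔ (c x + 1 < c y ∨ (c x + 1 = c y ∧ P x ∧ P y))

/-- A tight pair, oriented so that raising the head of the arc (or lowering its tail) slightly
keeps the relation between its two elements. -/
def TightArc {X : Type*} (c : X → ℝ) (P : X → Prop) (u v : X) : Prop :=
  (c u + 1 = c v ∧ P u ∧ P v) ∨ (c v + 1 = c u ∧ ¬(P v ∧ P u))

/-- The set of pairs of elements whose centers are at distance exactly one. -/
def tightPairs {X : Type*} (c : X → ℝ) : Set (X × X) := {p | c p.1 + 1 = c p.2}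

section

variable {X : Type*} {prec : X → X → Prop} {c : X → ℝ} {P : X → Prop}

theorem exists_pos_lt_gap [Finite X] (c : X → ℝ) :
    ∃ ε : ℝ, 0 < ε ∧ ∀ x y, c x + 1 ≠ c y → ε < |c y - (c x + 1)| := by
  have h : ∀ᶠ ε in nhdsWithin (0 : ℝ) (Set.Ioi 0),
      ∀ x y, c x + 1 ≠ c y → ε < |c y - (c x + 1)| := by
    simp only [Filter.eventually_all]
    intro x y hxy
    exact nhdsWithin_le_nhds (eventually_lt_nhds (abs_pos.2 (sub_ne_zero.2 (Ne.symm hxy))))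
  obtain ⟨ε, hε, hpos⟩ := (h.and self_mem_nhdsWithin).exists
  exact ⟨ε, hpos, hε⟩

/-- If some tight arc cannot be reversed, the representation can be perturbed to one with fewer
tight pairs. -/
theorem ACCenters.exists_fewer_tightPairs [Finite X] (hc : ACCenters prec c P) {u v : X}
    (huv : TightArc c P u v) (hvu : ¬ Relation.ReflTransGen (TightArc c P) v u) :
    ∃ c', ACCenters prec c' P ∧ (tightPairs c').ncard < (tightPairs c).ncard := by
  classical
  obtain ⟨ε, hε, hgap⟩ := exists_pos_lt_gap c
  let R : Set X := {w | Relation.ReflTransGen (TightArc c P) v w}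
  have hR : ∀ a b, TightArc c P a b → a ∈ R → b ∈ R := fun a b hab ha => ha.tail hab
  have hv : v ∈ R := Relation.ReflTransGen.refl
  have hu : u ∉ R := hvu
  let c' : X → ℝ := fun w => c w + if w ∈ R then ε else 0
  have hlt : ∀ x y, c x + 1 < c y → c' x + 1 < c' y := by
    intro x y h
    have := hgap x y h.ne
    rw [abs_of_pos (by linarith)] at this
    simp only [c']
    split_ifs <;> linarith
  have hgt : ∀ x y, c y < c x + 1 → c' y < c' x + 1 := by
    intro x y h
    have := hgap x y h.ne'
    rw [abs_of_neg (by linarith)] at this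
    simp only [c']
    split_ifs <;> linarith
  have htight : ∀ x y, c' x + 1 = c' y → c x + 1 = c y := by
    intro x y h
    rcases lt_trichotomy (c x + 1) (c y) with h' | h' | h'
    · exact absurd h (hlt x y h').ne
    · exact h'
    · exact absurd h (hgt x y h').ne'
  refine ⟨c', fun x y => ?_, Set.ncard_lt_ncard ?_ (Set.toFinite _)⟩
  · rw [hc x y]
    rcases lt_trichotomy (c x + 1) (c y) with h | h | h
    · simp [h, hlt x y h]
    · by_cases hP : P x ∧ P y
      · have hxy := hR x y (Or.inl ⟨h, hP⟩)
        have : c' x + 1 ≤ c' y := by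
          simp only [c']
          split_ifs <;> first | linarith | exact absurd (hxy ‹_›) ‹_›
        simpa [h, hP] using this.lt_or_eq
      · have hyx := hR y x (Or.inr ⟨h, hP⟩)
        have : c' y ≤ c' x + 1 := by
          simp only [c']
          split_ifs <;> first | linarith | exact absurd (hyx ‹_›) ‹_›
        simp [h, hP, this]
    · have := hgt x y h
      simp [h.ne', this.ne', h.not_gt, this.not_gt]
  · refine ⟨fun p hp => htight _ _ hp, fun hsub => ?_⟩
    rcases huv with ⟨h, -⟩ | ⟨h, -⟩
    · have : c' u + 1 = c' v := @hsub (u, v) h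
      simp only [c', hu, hv, if_true, if_false] at this
      linarith
    · have : c' v + 1 = c' u := @hsub (v, u) h
      simp only [c', hu, hv, if_true, if_false] at this
      linarith

/-- Every `{A,C}`-representation can be improved to one in which all tight arcs lie on cycles. -/
theorem ACCenters.exists_reversible [Finite X] (hc : ACCenters prec c P) :
    ∃ c', ACCenters prec c' P ∧
      ∀ u v, TightArc c' P u v → Relation.ReflTransGen (TightArc c' P) v u := by
  induction hn : (tightPairs c).ncard using Nat.strong_induction_on generalizing c with
  | _ n ih =>
    by_cases h : ∀ u v, TightArc c P u v → Relation.ReflTransGen (TightArc c P) v u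
    · exact ⟨c, hc, h⟩
    · push Not at h
      obtain ⟨u, v, huv, hvu⟩ := h
      obtain ⟨c', hc', hlt⟩ := hc.exists_fewer_tightPairs huv hvu
      exact ih _ (hn ▸ hlt) hc' rfl

/-- A walk of tight arcs climbs only along pairs of elements of type `C`. -/
theorem exists_up_step {p q : X} (h : Relation.ReflTransGen (TightArc c P) p q) :
    ∀ k : ℕ, c p + k < c q → ∃ u v, P u ∧ P v ∧ c u = c p + k ∧ c v = c p + k + 1 := by
  induction h using Relation.ReflTransGen.head_induction_on with
  | refl =>
    intro k hk
    have : (0 : ℝ) ≤ k := k.cast_nonneg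
    linarith
  | @head p p' hpp' _ ih =>
    intro k hk
    rcases hpp' with ⟨h, hp, hp'⟩ | ⟨h, -⟩
    · cases k with
      | zero => exact ⟨p, p', hp, hp', by simp, by simp [h]⟩
      | succ k =>
        push_cast at hk ⊢
        obtain ⟨u, v, hu, hv, hcu, hcv⟩ := ih k (by linarith)
        exact ⟨u, v, hu, hv, by linarith, by linarith⟩
    · obtain ⟨u, v, hu, hv, hcu, hcv⟩ := ih (k + 1) (by push_cast; linarith)
      push_cast at hcu hcv
      exact ⟨u, v, hu, hv, by linarith, by linarith⟩

/-- A walk of tight arcs descends only along pairs that are not both of type `C`. -/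
theorem exists_down_step {p q : X} (h : Relation.ReflTransGen (TightArc c P) p q) :
    ∀ k : ℕ, c q + k < c p →
      ∃ u v, ¬(P u ∧ P v) ∧ c u = c q + k ∧ c v = c q + k + 1 := by
  induction h with
  | refl =>
    intro k hk
    have : (0 : ℝ) ≤ k := k.cast_nonneg
    linarith
  | @tail q' q _ hq ih =>
    intro k hk
    rcases hq with ⟨h, -⟩ | ⟨h, hP⟩
    · obtain ⟨u, v, huv, hcu, hcv⟩ := ih (k + 1) (by push_cast; linarith)
      push_cast at hcu hcv
      exact ⟨u, v, huv, by linarith, by linarith⟩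
    · cases k with
      | zero => exact ⟨q, q', hP, by simp, by simp [h]⟩
      | succ k =>
        push_cast at hk ⊢
        obtain ⟨u, v, huv, hcu, hcv⟩ := ih k (by linarith)
        exact ⟨u, v, huv, by linarith, by linarith⟩

/-- Four elements of type `C` at consecutive unit distances and two of type `A` alongside the
middle ones form an induced copy of `Z`. -/
theorem ACCenters.containsInduced_relZ (hc : ACCenters prec c P) {x y z w a b : X}
    (hx : P x) (hy : P y) (hz : P z) (hw : P w) (ha : ¬ P a) (hb : ¬ P b)
    (hxa : c x + 1 = c a) (hya : c y = c a) (hza : c z = c a + 1) (hwa : c w = c a + 2)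
    (hba : c b = c a + 1) : ContainsInduced prec relZ := by
  have hrel : ∀ i j, relZ i j ↔ prec (![x, y, z, w, a, b] i) (![x, y, z, w, a, b] j) := by
    obtain hxa : c x = c a - 1 := by linarith
    intro i j
    rw [hc]
    fin_cases i <;> fin_cases j <;>
      simp [relZ, hx, hy, hz, hw, ha, hb, hxa, hya, hza, hwa, hba] <;> grind
  refine ⟨_, ?_, hrel⟩
  have hne : ∀ s t, c s ≠ c t ∨ ¬(P s ↔ P t) → s ≠ t := by
    rintro s t h rfl
    simp at h
  intro i j hij
  contrapose! hij
  apply hne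
  revert hij
  fin_cases i <;> fin_cases j <;> simp [hx, hy, hz, hw, ha, hb] <;> grind

/-- With all tight arcs reversible and no induced `Z`, two elements of type `A` are never tight. -/
theorem ACCenters.not_tight_of_not (hc : ACCenters prec c P)
    (hrev : ∀ u v, TightArc c P u v → Relation.ReflTransGen (TightArc c P) v u)
    (hZ : ¬ ContainsInduced prec relZ) {a b : X} (ha : ¬ P a) (hb : ¬ P b) :
    c a + 1 ≠ c b := by
  intro hab
  have hreach := hrev b a (Or.inr ⟨hab, fun h => ha h.1⟩)
  have hne : a ≠ b := by
    rintro rfl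
    linarith
  obtain rfl | ⟨a', haa', hreach⟩ := hreach.cases_head
  · exact hne rfl
  have ha' : c a' + 1 = c a := by
    rcases haa' with h | h
    · exact absurd h.2.1 ha
    · exact h.1
  obtain hab' | ⟨b', hreach, hbb'⟩ := hreach.cases_tail
  · rw [hab'] at hab
    linarith
  have hb' : c b + 1 = c b' := by
    rcases hbb' with h | h
    · exact absurd h.2.2 hb
    · exact h.1
  obtain ⟨x, y, hx, hy, hcx, hcy⟩ := exists_up_step hreach 0 (by push_cast; linarith)
  obtain ⟨z, w, hz, hw, hcz, hcw⟩ := exists_up_step hreach 2 (by push_cast; linarith)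
  push_cast at *
  exact hZ (hc.containsInduced_relZ hx hy hz hw ha hb (by linarith) (by linarith) (by linarith)
    (by linarith) (by linarith))

/-- When no two elements of type `A` are tight, replacing `A` by `D` gives a
`{C,D}`-representation. -/
theorem ACCenters.sOrder_CD (hc : ACCenters prec c P)
    (hA : ∀ a b, ¬ P a → ¬ P b → c a + 1 ≠ c b) : SOrder prec {IType.C, IType.D} := by
  classical
  refine ⟨c, fun x => if P x then IType.C else IType.D, fun x => ?_, fun x y => ?_⟩
  · by_cases h : P x <;> simp [h]
  · rw [hc]
    have := hA x y
    by_cases hx : P x <;> by_cases hy : P y <;> simp_all [typeComp]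

/-- When no two elements of type `A` are tight but every tight pair of type `C` is at the level
of some element of type `A`, a `{A,B}`-representation is obtained by giving type `B` to the
elements of type `C` at such levels, and type `A` to all others. -/
theorem ACCenters.sOrder_AB (hc : ACCenters prec c P)
    (hA : ∀ a b, ¬ P a → ¬ P b → c a + 1 ≠ c b)
    (hC : ∀ u v, P u → P v → c u + 1 = c v → ∃ a, ¬ P a ∧ (c a = c u ∨ c a = c v)) :
    SOrder prec {IType.A, IType.B} := by
  classical
  let Q : X → Prop := fun x => P x ∧ ∃ a, ¬ P a ∧ c a = c x
  refine ⟨c, fun x => if Q x then IType.B else IType.A, fun x => ?_, fun x y => ?_⟩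
  · by_cases h : Q x <;> simp [h]
  · rw [hc]
    refine or_congr_right (and_congr_right fun hxy => ?_)
    have hcomp : typeComp (if Q x then IType.B else IType.A) (if Q y then IType.B else IType.A) ↔
        Q x ∨ Q y := by
      by_cases hx : Q x <;> by_cases hy : Q y <;> simp [hx, hy, typeComp]
    rw [hcomp]
    constructor
    · rintro ⟨hx, hy⟩
      obtain ⟨a, ha, h | h⟩ := hC x y hx hy hxy
      · exact Or.inl ⟨hx, a, ha, h⟩
      · exact Or.inr ⟨hy, a, ha, h⟩
    · rintro (⟨hx, a, ha, h⟩ | ⟨hy, a, ha, h⟩)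
      · exact ⟨hx, by_contra fun hy => hA a y ha hy (h ▸ hxy)⟩
      · exact ⟨by_contra fun hx => hA x a hx ha (h ▸ hxy), hy⟩

end


/-- a finite `{A,C}`-order with no induced `Z` is an `{A,B}`-order and a
`{C,D}`-order. -/
theorem stmt_11 {X : Type*} [Finite X] (prec : X → X → Prop)
    (hirr : ∀ x, ¬ prec x x)
    (htrans : ∀ x y z, prec x y → prec y z → prec x z)
    (hAC : SOrder prec {IType.A, IType.C})
    (hZ : ¬ ContainsInduced prec relZ) :
    SOrder prec {IType.A, IType.B} ∧ SOrder prec {IType.C, IType.D} := by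
  obtain ⟨c₀, τ, hτ, hrep⟩ := hAC
  have hc₀ : ACCenters prec c₀ (fun x => τ x = IType.C) := fun x y => by
    rw [hrep]
    rcases hτ x with hx | hx <;> rcases hτ y with hy | hy <;> simp_all [typeComp]
  obtain ⟨c, hc, hrev⟩ := hc₀.exists_reversible
  have hA := fun a b ha hb => hc.not_tight_of_not hrev hZ (a := a) (b := b) ha hb
  refine ⟨hc.sOrder_AB hA fun u v hu hv huv => ?_, hc.sOrder_CD hA⟩
  obtain ⟨s, t, hst, hs, ht⟩ :=
    exists_down_step (hrev u v (Or.inl ⟨huv, hu, hv⟩)) 0 (by push_cast; linarith)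
  push_cast at hs ht
  rcases not_and_or.1 hst with h | h
  · exact ⟨s, h, Or.inl (by linarith)⟩
  · exact ⟨t, h, Or.inr (by linarith)⟩
end
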